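/- arXiv:1701.07965 — 2 statements merged into one kernel-verified Lean document; each statement's English description precedes it below -/
import Mathlib

section
/- Let X be a set, I a nonempty finite set, and (f_i)_{i∈I} a family of functions f_i : X → X having attractor. Then there exist a metric d on X and a comparison function φ : [0,∞) → [0,∞) such that: (a) the metric space (X,d) is complete and bounded; (b) for every i ∈ I, f_i is a φ-contraction with respect to d, i.e. d(f_i(x), f_i(y)) ≤ φ(d(x,y)) for all x,y ∈ X. -/
open Filter Topology Set

/-- `φ : [0,∞) → [0,∞)` is a comparison function: it maps `[0,∞)` into `[0,∞)`,
is increasing, satisfies `φ t < t` for `t > 0`, and is right-continuous. -/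
def IsComparisonFn (φ : ℝ → ℝ) : Prop :=
  (∀ t : ℝ, 0 ≤ t → 0 ≤ φ t) ∧
  MonotoneOn φ (Set.Ici (0 : ℝ)) ∧
  (∀ t : ℝ, 0 < t → φ t < t) ∧
  (∀ t : ℝ, 0 ≤ t → ContinuousWithinAt φ (Set.Ici t) t)

/-- `f_{α₁…αₙ} = f_{α₁} ∘ f_{α₂} ∘ … ∘ f_{αₙ}` (the identity for the empty word). -/
def WordMap {X I : Type*} (f : I → X → X) : List I → X → X
  | [] => id
  | i :: w => f i ∘ WordMap f w

/-- `[α]_n`: the finite word consisting of the first `n` letters of the infinite word `α`. -/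
def Pref {I : Type*} (α : ℕ → I) (n : ℕ) : List I := List.ofFn (fun k : Fin n => α (k : ℕ))

/-- `X_w = f_w(X)`, the image of the whole space under the word map. -/
def WordSet {X I : Type*} (f : I → X → X) (w : List I) : Set X := Set.range (WordMap f w)

/-- A family `(f_i)_{i ∈ I}` of self-maps of `X` has attractor if:
(a) for every infinite word `α`, `⋂ₙ X_{[α]ₙ}` has a unique element `a_α`;
(b) whenever `a_α ≠ a_β`, some `X_{[α]_{n₀}}` and `X_{[β]_{n₀}}` are disjoint. -/
def HasAttractor {X I : Type*} (f : I → X → X) : Prop :=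
  (∀ α : ℕ → I, ∃! a : X, ∀ n : ℕ, a ∈ WordSet f (Pref α n)) ∧
  (∀ α β : ℕ → I, ∀ a b : X,
    (∀ n : ℕ, a ∈ WordSet f (Pref α n)) → (∀ n : ℕ, b ∈ WordSet f (Pref β n)) →
    a ≠ b →
    ∃ n₀ : ℕ, WordSet f (Pref α n₀) ∩ WordSet f (Pref β n₀) = ∅)


section helpers

variable {X I : Type*}

lemma pref_cons (i : I) (α : ℕ → I) (n : ℕ) :
    Pref (fun k => Nat.casesOn k i α : ℕ → I) (n + 1) = i :: Pref α n := by
  simp [Pref, List.ofFn_succ]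

lemma pref_snoc (α : ℕ → I) (n : ℕ) : Pref α (n + 1) = Pref α n ++ [α n] := by
  unfold Pref
  rw [List.ofFn_succ_last]
  simp

lemma wordMap_append (f : I → X → X) (w : List I) (i : I) (x : X) :
    WordMap f (w ++ [i]) x = WordMap f w (f i x) := by
  induction w with
  | nil => rfl
  | cons j w ih => simp [WordMap, ih]

lemma wordSet_succ (f : I → X → X) (α : ℕ → I) (n : ℕ) {x : X}
    (h : x ∈ WordSet f (Pref α (n + 1))) : x ∈ WordSet f (Pref α n) := by
  obtain ⟨y, rfl⟩ := h
  rw [pref_snoc, wordMap_append]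
  exact ⟨_, rfl⟩

lemma wordSet_cons (f : I → X → X) (i : I) (α : ℕ → I) (n : ℕ) {x : X}
    (h : x ∈ WordSet f (Pref α n)) :
    f i x ∈ WordSet f (Pref (fun k => Nat.casesOn k i α : ℕ → I) (n + 1)) := by
  obtain ⟨y, rfl⟩ := h
  rw [pref_cons]
  exact ⟨y, rfl⟩

lemma konig_words {J : Type} [Finite J] [Finite I] (P : ℕ → (J → List I) → Prop)
    (anti : ∀ n (q : J → ℕ → I), P (n + 1) (fun j => Pref (q j) (n + 1)) →
      P n (fun j => Pref (q j) n))
    (ne : ∀ n, ∃ q : J → ℕ → I, P n (fun j => Pref (q j) n)) :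
    ∃ q : J → ℕ → I, ∀ n, P n (fun j => Pref (q j) n) := by
  letI : TopologicalSpace I := ⊥
  haveI : DiscreteTopology I := ⟨rfl⟩
  have hcl : ∀ n, IsClosed {q : J → ℕ → I | P n (fun j => Pref (q j) n)} := by
    intro n
    have hc : Continuous (fun (q : J → ℕ → I) (j : J) (k : Fin n) => q j k) := by fun_prop
    exact (isClosed_discrete {r : J → Fin n → I | P n (fun j => List.ofFn (r j))}).preimage hc
  obtain ⟨q, hq⟩ := IsCompact.nonempty_iInter_of_sequence_nonempty_isCompact_isClosed
    (fun n => {q : J → ℕ → I | P n (fun j => Pref (q j) n)})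
    (fun n q h => anti n q h) ne (hcl 0).isCompact hcl
  exact ⟨q, fun n => by simpa using Set.mem_iInter.1 hq n⟩

/-- The cells of two words meet. -/
def CellsMeet (f : I → X → X) (w v : List I) : Prop :=
  (WordSet f w ∩ WordSet f v).Nonempty

/-- The basic entourages. -/
def Ent (f : I → X → X) (n : ℕ) (x y : X) : Prop :=
  x = y ∨ ∃ α β : ℕ → I, x ∈ WordSet f (Pref α n) ∧ y ∈ WordSet f (Pref β n) ∧
    CellsMeet f (Pref α n) (Pref β n)

lemma CellsMeet.down {f : I → X → X} {α β : ℕ → I} {n : ℕ}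
    (h : CellsMeet f (Pref α (n + 1)) (Pref β (n + 1))) :
    CellsMeet f (Pref α n) (Pref β n) := by
  obtain ⟨z, h1, h2⟩ := h
  exact ⟨z, wordSet_succ f α n h1, wordSet_succ f β n h2⟩

lemma Ent.symm {f : I → X → X} {n : ℕ} {x y : X} (h : Ent f n x y) : Ent f n y x := by
  rcases h with h | ⟨α, β, h1, h2, z, h3, h4⟩
  · exact Or.inl h.symm
  · exact Or.inr ⟨β, α, h2, h1, z, h4, h3⟩

lemma ent_anti (f : I → X → X) (x y : X) : Antitone (fun n => Ent f n x y) := by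
  refine antitone_nat_of_succ_le fun n h => ?_
  rcases h with h | ⟨α, β, h1, h2, h3⟩
  · exact Or.inl h
  · exact Or.inr ⟨α, β, wordSet_succ f α n h1, wordSet_succ f β n h2, h3.down⟩

lemma ent_zero [Nonempty I] (f : I → X → X) (x y : X) : Ent f 0 x y := by
  obtain ⟨i⟩ := ‹Nonempty I›
  exact Or.inr ⟨fun _ => i, fun _ => i, ⟨x, rfl⟩, ⟨y, rfl⟩, x, ⟨x, rfl⟩, ⟨x, rfl⟩⟩

lemma Ent.map {f : I → X → X} {n : ℕ} {x y : X} (h : Ent f n x y) (i : I) :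
    Ent f (n + 1) (f i x) (f i y) := by
  rcases h with h | ⟨α, β, h1, h2, z, h3, h4⟩
  · exact Or.inl (by rw [h])
  · exact Or.inr ⟨_, _, wordSet_cons f i α n h1, wordSet_cons f i β n h2, f i z,
      wordSet_cons f i α n h3, wordSet_cons f i β n h4⟩

lemma Ent.wordMap {f : I → X → X} {n : ℕ} {x y : X} (h : Ent f n x y) (w : List I) :
    Ent f (n + w.length) (WordMap f w x) (WordMap f w y) := by
  induction w with
  | nil => exact h
  | cons i w ih => exact ih.map i

lemma eq_of_meet {f : I → X → X} (hF : HasAttractor f) {α β : ℕ → I}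
    (h : ∀ n, CellsMeet f (Pref α n) (Pref β n)) {a b : X}
    (ha : ∀ n, a ∈ WordSet f (Pref α n)) (hb : ∀ n, b ∈ WordSet f (Pref β n)) : a = b := by
  by_contra hab
  obtain ⟨n, hn⟩ := hF.2 α β a b ha hb hab
  exact (h n).ne_empty hn

lemma ent_sep [Finite I] {f : I → X → X} (hF : HasAttractor f) {x y : X}
    (h : ∀ n, Ent f n x y) : x = y := by
  by_contra hxy
  obtain ⟨q, hq⟩ := konig_words (J := Fin 2) (I := I)
    (fun _ w => x ∈ WordSet f (w 0) ∧ y ∈ WordSet f (w 1) ∧ CellsMeet f (w 0) (w 1))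
    (fun n q h => ⟨wordSet_succ f _ n h.1, wordSet_succ f _ n h.2.1, h.2.2.down⟩)
    (fun n => by
      rcases h n with h | ⟨α, β, h⟩
      · exact absurd h hxy
      · exact ⟨![α, β], by simpa using h⟩)
  exact hxy (eq_of_meet hF (fun n => (hq n).2.2) (fun n => (hq n).1) (fun n => (hq n).2.1))

lemma ent_comp [Finite I] {f : I → X → X} (hF : HasAttractor f) (n : ℕ) :
    ∃ m, ∀ x y z, Ent f m x y → Ent f m y z → Ent f n x z := by
  by_contra hcon
  push Not at hcon
  have key : ∀ m, ∃ q : Fin 4 → ℕ → I, CellsMeet f (Pref (q 0) m) (Pref (q 1) m) ∧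
      CellsMeet f (Pref (q 1) m) (Pref (q 2) m) ∧ CellsMeet f (Pref (q 2) m) (Pref (q 3) m) ∧
      ¬ CellsMeet f (Pref (q 0) n) (Pref (q 3) n) := by
    intro m
    obtain ⟨x, y, z, h1, h2, h3⟩ := hcon (max m n)
    have h1' := ent_anti f _ _ (le_max_right m n) h1
    have h2' := ent_anti f _ _ (le_max_right m n) h2
    rcases h1 with rfl | ⟨α, β, hx, hy, hm⟩
    · exact absurd h2' h3
    rcases h2 with rfl | ⟨γ, δ, hy', hz, hm'⟩
    · exact absurd h1' h3
    have hd : ∀ (a : ℕ → I) (k l : ℕ), k ≤ l → WordSet f (Pref a l) ⊆ WordSet f (Pref a k) :=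
      fun a k l hkl => antitone_nat_of_succ_le
        (f := fun k => WordSet f (Pref a k)) (fun k _ h => wordSet_succ f a k h) hkl
    have hl := le_max_left m n
    have hr := le_max_right m n
    refine ⟨![α, β, γ, δ], ?_, ?_, ?_, ?_⟩
    · exact hm.mono (Set.inter_subset_inter (hd _ _ _ hl) (hd _ _ _ hl))
    · exact ⟨y, hd _ _ _ hl hy, hd _ _ _ hl hy'⟩
    · exact hm'.mono (Set.inter_subset_inter (hd _ _ _ hl) (hd _ _ _ hl))
    · intro hc
      exact h3 (Or.inr ⟨α, δ, hd _ _ _ hr hx, hd _ _ _ hr hz, hc⟩)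
  obtain ⟨q, hq⟩ := konig_words (J := Fin 4) (I := I)
    (fun m w => CellsMeet f (w 0) (w 1) ∧ CellsMeet f (w 1) (w 2) ∧ CellsMeet f (w 2) (w 3) ∧
      (n ≤ m → ¬ CellsMeet f ((w 0).take n) ((w 3).take n)))
    (fun m q h => ⟨h.1.down, h.2.1.down, h.2.2.1.down, fun hnm => by
      have := h.2.2.2 (by omega)
      simp only [pref_snoc] at this
      rwa [List.take_append_of_le_length (by simpa [Pref] using hnm),
        List.take_append_of_le_length (by simpa [Pref] using hnm)] at this⟩)
    (fun m => by
      obtain ⟨q, h1, h2, h3, h4⟩ := key m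
      refine ⟨q, h1, h2, h3, fun hnm hc => h4 ?_⟩
      have ht : ∀ a : ℕ → I, (Pref a m).take n = Pref a n := by
        intro a
        apply List.ext_getElem <;> simp [Pref, hnm]
      simpa only [ht] using hc)
  choose a ha _ using hF.1
  have e1 := eq_of_meet hF (fun n => (hq n).1) (ha _) (ha _)
  have e2 := eq_of_meet hF (fun n => (hq n).2.1) (ha _) (ha _)
  have e3 := eq_of_meet hF (fun n => (hq n).2.2.1) (ha _) (ha _)
  have hlen : ∀ b : ℕ → I, (Pref b n).take n = Pref b n := fun b => by simp [Pref]
  have := (hq n).2.2.2 le_rfl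
  simp only [hlen] at this
  exact this ⟨a (q 0), ha _ n, by rw [e1, e2, e3]; exact ha _ n⟩

lemma complete_of_ent [Finite I] {f : I → X → X} (hF : HasAttractor f) [MetricSpace X]
    (h1 : ∀ ε > 0, ∃ n, ∀ x y, Ent f n x y → dist x y < ε)
    (h2 : ∀ n, ∃ ε > 0, ∀ x y : X, dist x y < ε → Ent f n x y) : CompleteSpace X := by
  refine Metric.complete_of_cauchySeq_tendsto fun u hu => ?_
  by_cases hc : ∃ N, ∀ k ≥ N, u k = u N
  · obtain ⟨N, hN⟩ := hc
    exact ⟨u N, tendsto_const_nhds.congr' (by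
      filter_upwards [eventually_ge_atTop N] with k hk using (hN k hk).symm)⟩
  push Not at hc
  obtain ⟨q, hq⟩ := konig_words (J := Unit) (I := I)
    (fun _ w => ∃ᶠ k in atTop, u k ∈ WordSet f (w ()))
    (fun n q h => h.mono fun k hk => wordSet_succ f _ n hk)
    (fun n => by
      by_contra hcon
      have hcon' : ∀ v : Fin n → I, ∀ᶠ k in atTop, u k ∉ WordSet f (List.ofFn v) := by
        intro v
        by_contra hv
        have hI : ∃ α : ℕ → I, Pref α n = List.ofFn v := by
          by_cases hn : n = 0
          · subst hn
            obtain ⟨k, hk, hk'⟩ := hc 0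
            obtain ⟨ε, hε, he⟩ := h2 0
            obtain ⟨N, hN⟩ := Metric.cauchySeq_iff.1 hu ε hε
            obtain ⟨k, hk, hk'⟩ := hc N
            rcases he _ _ (hN k hk N le_rfl) with h | ⟨α, _⟩
            · exact absurd h hk'
            · exact ⟨α, by simp [Pref]⟩
          · refine ⟨fun k => if h : k < n then v ⟨k, h⟩ else v ⟨0, by omega⟩, ?_⟩
            simp [Pref]
        obtain ⟨α, hα⟩ := hI
        refine hcon ⟨fun _ => α, ?_⟩
        simp only [hα]
        exact hv
      have hall := eventually_all.2 hcon'
      obtain ⟨M, hM⟩ := eventually_atTop.1 hall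
      obtain ⟨ε, hε, he⟩ := h2 n
      obtain ⟨N, hN⟩ := Metric.cauchySeq_iff.1 hu ε hε
      obtain ⟨k, hk, hk'⟩ := hc (max M N)
      rcases he _ _ (hN k (le_trans (le_max_right _ _) hk) (max M N) (le_max_right _ _)) with
        h | ⟨α, β, hα, _⟩
      · exact hk' h
      · exact hM k (le_trans (le_max_left _ _) hk) (fun j => α j) hα)
  obtain ⟨a, ha, -⟩ := hF.1 (q ())
  refine ⟨a, Metric.tendsto_atTop.2 fun ε hε => ?_⟩
  obtain ⟨n, hn⟩ := h1 (ε / 2) (by linarith)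
  obtain ⟨N, hN⟩ := Metric.cauchySeq_iff.1 hu (ε / 2) (by linarith)
  obtain ⟨k, hk, hk'⟩ := frequently_atTop.1 (hq n) N
  refine ⟨N, fun l hl => ?_⟩
  have d1 := hN l hl k hk
  have d2 := hn (u k) a (Or.inr ⟨q (), q (), hk', ha n, a, ha n, ha n⟩)
  linarith [dist_triangle (u l) (u k) a]

lemma exists_sigma [Finite I] {f : I → X → X} (hF : HasAttractor f) :
    ∃ σ : X → X → ℝ, (∀ x y, 0 ≤ σ x y) ∧ (∀ x y, σ x y ≤ 1) ∧ (∀ x, σ x x = 0) ∧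
      (∀ x y, σ x y = σ y x) ∧ (∀ x y z, σ x z ≤ σ x y + σ y z) ∧
      (∀ ε > 0, ∃ n, ∀ x y, Ent f n x y → σ x y < ε) ∧
      (∀ n, ∃ ε > 0, ∀ x y : X, σ x y < ε → Ent f n x y) := by
  have hdir : Antitone (fun n => {p : X × X | Ent f n p.1 p.2}) :=
    fun n m h p hp => ent_anti f _ _ h hp
  have hb : (⨅ n, 𝓟 {p : X × X | Ent f n p.1 p.2}).HasBasis (fun _ : ℕ => True)
      (fun n => {p : X × X | Ent f n p.1 p.2}) :=
    hasBasis_iInf_principal (directed_of_isDirected_le fun n m h => hdir h)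
  let c : UniformSpace.Core X := UniformSpace.Core.mk
    (⨅ n, 𝓟 {p : X × X | Ent f n p.1 p.2})
    (by
      refine le_iInf fun n => ?_
      rw [principal_mono]
      rintro ⟨x, y⟩ h
      exact Or.inl (by simpa using h))
    (by
      refine (hb.tendsto_iff hb).2 fun n _ => ⟨n, trivial, fun p hp => Ent.symm hp⟩)
    (by
      intro s hs
      obtain ⟨n, -, hn⟩ := hb.mem_iff.1 hs
      obtain ⟨m, hm⟩ := ent_comp hF n
      refine (Filter.mem_lift'_sets (monotone_id.relComp monotone_id)).2
        ⟨_, hb.mem_of_mem (i := m) trivial, ?_⟩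
      rintro ⟨x, z⟩ ⟨y, hxy, hyz⟩
      exact hn (hm x y z hxy hyz))
  letI us : UniformSpace X := UniformSpace.ofCore c
  have hbu : (uniformity X).HasBasis (fun _ : ℕ => True)
      (fun n => {p : X × X | Ent f n p.1 p.2}) := hb
  haveI : IsCountablyGenerated (uniformity X) := hbu.isCountablyGenerated
  letI pm := UniformSpace.pseudoMetricSpace X
  refine ⟨fun x y => min 1 (dist x y), fun x y => le_min zero_le_one dist_nonneg,
    fun x y => min_le_left _ _, fun x => by simp, fun x y => by simp only [dist_comm], ?_, ?_, ?_⟩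
  · intro x y z
    have := dist_triangle x y z
    have h1 := dist_nonneg (x := x) (y := y)
    have h2 := dist_nonneg (x := y) (y := z)
    rcases min_cases 1 (dist x y) with h | h <;> rcases min_cases 1 (dist y z) with h' | h' <;>
    rcases min_cases 1 (dist x z) with h'' | h'' <;> linarith
  · intro ε hε
    obtain ⟨n, -, hn⟩ := hbu.mem_iff.1 (Metric.dist_mem_uniformity hε)
    exact ⟨n, fun x y h => lt_of_le_of_lt (min_le_right _ _) (hn (show (x, y) ∈ _ from h))⟩
  · intro n
    obtain ⟨ε, hε, h⟩ := Metric.mem_uniformity_dist.1 (hbu.mem_of_mem (i := n) trivial)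
    refine ⟨min 1 ε, lt_min one_pos hε, fun x y hxy => h ?_⟩
    rcases min_lt_iff.1 hxy with h' | h'
    · exact absurd h' (not_lt.2 (min_le_left _ _))
    · exact lt_of_lt_of_le h' (min_le_right _ _)

/-- The weights. -/
noncomputable def cw (n : ℕ) : ℝ := 2 - 1 / ((n : ℝ) + 1)

/-- The weight ratios. -/
noncomputable def ratioW (n : ℕ) : ℝ := 1 - 1 / (((n : ℝ) + 1) * (2 * n + 3))

lemma cw_le (n : ℕ) : cw n ≤ 2 := by
  have : 0 ≤ 1 / ((n : ℝ) + 1) := by positivity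
  unfold cw; linarith

lemma one_le_cw (n : ℕ) : 1 ≤ cw n := by
  have : 1 / ((n : ℝ) + 1) ≤ 1 := by
    rw [div_le_one (by positivity)]; linarith [Nat.cast_nonneg (α := ℝ) n]
  unfold cw; linarith

lemma cw_eq (n : ℕ) : cw n = ratioW n * cw (n + 1) := by
  unfold cw ratioW
  push_cast
  field_simp
  ring

lemma rw_nonneg (n : ℕ) : 0 ≤ ratioW n := by
  have hn := Nat.cast_nonneg (α := ℝ) n
  have : 1 / (((n : ℝ) + 1) * (2 * n + 3)) ≤ 1 := by
    rw [div_le_one (by positivity)]; nlinarith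
  unfold ratioW; linarith

lemma rw_lt_one (n : ℕ) : ratioW n < 1 := by
  have : 0 < 1 / (((n : ℝ) + 1) * (2 * n + 3)) := by positivity
  unfold ratioW; linarith

lemma rw_mono : Monotone ratioW := by
  intro m n h
  have h' : (m : ℝ) ≤ n := by exact_mod_cast h
  have : 1 / (((n : ℝ) + 1) * (2 * n + 3)) ≤ 1 / (((m : ℝ) + 1) * (2 * m + 3)) := by
    gcongr
  unfold ratioW; linarith

lemma phi_comparison (M : ℕ → ℝ) (h0 : ∀ n, 0 ≤ M n)
    (hM : ∀ ε > 0, ∃ N, ∀ n ≥ N, M n ≤ ε) :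
    IsComparisonFn (fun t => ⨆ n, ratioW n * min t (M n)) ∧
      ∀ t n, ratioW n * min t (M n) ≤ ⨆ n, ratioW n * min t (M n) := by
  have hle : ∀ s t n, ratioW n * min s (M n) ≤ ratioW n * min t (M n) + |s - t| := by
    intro s t n
    have h1 : min s (M n) ≤ min t (M n) + |s - t| := by
      have := le_abs_self (s - t)
      have := abs_nonneg (s - t)
      rcases min_cases s (M n) with h | h <;> rcases min_cases t (M n) with h' | h' <;> linarith
    have h2 := rw_nonneg n
    have h3 := (rw_lt_one n).le
    nlinarith [abs_nonneg (s - t)]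
  have hb0 : ∀ t n, ratioW n * min t (M n) ≤ |t| := fun t n => by
    have := hle t 0 n
    simpa [h0 n] using this
  have hbdd : ∀ t, BddAbove (Set.range fun n => ratioW n * min t (M n)) := fun t =>
    ⟨|t|, by rintro _ ⟨n, rfl⟩; exact hb0 t n⟩
  refine ⟨⟨?_, ?_, ?_, ?_⟩, fun t n => le_ciSup (hbdd t) n⟩
  · intro t ht
    exact Real.iSup_nonneg fun n => mul_nonneg (rw_nonneg n) (le_min ht (h0 n))
  · intro s _ t _ hst
    refine ciSup_mono (hbdd t) fun n => ?_
    exact mul_le_mul_of_nonneg_left (min_le_min_right _ hst) (rw_nonneg n)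
  · intro t ht
    obtain ⟨N, hN⟩ := hM (t / 2) (by linarith)
    refine lt_of_le_of_lt (b := max (t / 2) (ratioW N * t)) (ciSup_le fun n => ?_) ?_
    · rcases le_total N n with h | h
      · refine le_max_of_le_left ?_
        have h1 : min t (M n) ≤ t / 2 := (min_le_right _ _).trans (hN n h)
        have h2 : 0 ≤ min t (M n) := le_min ht.le (h0 n)
        nlinarith [rw_nonneg n, rw_lt_one n]
      · refine le_max_of_le_right ?_
        exact mul_le_mul (rw_mono h) (min_le_left _ _) (le_min ht.le (h0 n)) (rw_nonneg N)
    · refine max_lt (by linarith) ?_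
      nlinarith [rw_lt_one N]
  · intro t _
    have : LipschitzWith 1 (fun t => ⨆ n, ratioW n * min t (M n)) := by
      refine LipschitzWith.of_le_add fun s t => ?_
      refine ciSup_le fun n => (hle s t n).trans ?_
      rw [Real.dist_eq]
      gcongr
      exact le_ciSup (hbdd t) n
    exact this.continuous.continuousWithinAt

end helpers

/-- **Theorem 3.21.** For a family having attractor, there exist a metric `d` on `X`
and a comparison function `φ` such that `(X,d)` is complete and bounded and every
`f_i` is a `φ`-contraction with respect to `d`. -/
theorem exists_metric_comparison_of_hasAttractor {X I : Type*} [Finite I] [Nonempty I]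
    (f : I → X → X) (hF : HasAttractor f) :
    ∃ (m : MetricSpace X) (φ : ℝ → ℝ),
      IsComparisonFn φ ∧
      @CompleteSpace X m.toUniformSpace ∧
      (∃ C : ℝ, ∀ x y : X, m.dist x y ≤ C) ∧
      (∀ i : I, ∀ x y : X, m.dist (f i x) (f i y) ≤ φ (m.dist x y)) := by
  obtain ⟨σ, s0, s1, sr, ss, st, sE, Es⟩ := exists_sigma hF
  let g : List I → X → X → ℝ := fun w x y => cw w.length * σ (WordMap f w x) (WordMap f w y)
  have g0 : ∀ w x y, 0 ≤ g w x y := fun w x y =>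
    mul_nonneg (by linarith [one_le_cw w.length]) (s0 _ _)
  have gs : ∀ w x y, g w x y ≤ 2 * σ (WordMap f w x) (WordMap f w y) := fun w x y =>
    mul_le_mul_of_nonneg_right (cw_le _) (s0 _ _)
  have g2 : ∀ w x y, g w x y ≤ 2 := fun w x y => by
    linarith [gs w x y, s1 (WordMap f w x) (WordMap f w y)]
  let D : X → X → ℝ := fun x y => ⨆ w, g w x y
  have hbdd : ∀ x y, BddAbove (Set.range fun w => g w x y) := fun x y =>
    ⟨2, by rintro _ ⟨w, rfl⟩; exact g2 w x y⟩
  have gD : ∀ w x y, g w x y ≤ D x y := fun w x y => le_ciSup (hbdd x y) w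
  have sD : ∀ x y, σ x y ≤ D x y := fun x y => by
    have := gD [] x y
    have h2 : g [] x y = σ x y := by simp [g, cw, WordMap]; norm_num
    linarith
  have hDE : ∀ ε > 0, ∃ n, ∀ x y, Ent f n x y → D x y < ε := by
    intro ε hε
    obtain ⟨n, hn⟩ := sE (ε / 4) (by linarith)
    refine ⟨n, fun x y h => lt_of_le_of_lt (b := ε / 2) (ciSup_le fun w => ?_) (by linarith)⟩
    have := hn _ _ (ent_anti f _ _ (Nat.le_add_right n w.length) (h.wordMap w))
    linarith [gs w x y]
  have hED : ∀ n, ∃ ε > 0, ∀ x y, D x y < ε → Ent f n x y := by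
    intro n
    obtain ⟨ε, hε, h⟩ := Es n
    exact ⟨ε, hε, fun x y hxy => h x y (lt_of_le_of_lt (sD x y) hxy)⟩
  let m : MetricSpace X :=
    { dist := D
      dist_self := fun x => by simp [D, g, sr]
      dist_comm := fun x y => by simp only [D, g, ss]
      dist_triangle := fun x y z => by
        refine ciSup_le fun w => ?_
        have h1 := gD w x y
        have h2 := gD w y z
        have h3 : g w x z ≤ g w x y + g w y z := by
          simp only [g]
          rw [← mul_add]
          exact mul_le_mul_of_nonneg_left (st _ _ _) (by linarith [one_le_cw w.length])
        linarith
      eq_of_dist_eq_zero := fun {x y} h => by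
        refine ent_sep hF fun n => ?_
        obtain ⟨ε, hε, hh⟩ := hED n
        exact hh x y (lt_of_eq_of_lt h hε) }
  let M : ℕ → ℝ := fun n =>
    sSup {t | ∃ (w : List I) (x y : X), w.length = n ∧ t = g w x y}
  have M0 : ∀ n, 0 ≤ M n := fun n => Real.sSup_nonneg (by
    rintro _ ⟨w, x, y, -, rfl⟩; exact g0 w x y)
  have Mle : ∀ w x y, g w x y ≤ M w.length := fun w x y => le_csSup
    ⟨2, by rintro _ ⟨w, x, y, -, rfl⟩; exact g2 w x y⟩ ⟨w, x, y, rfl, rfl⟩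
  have hM : ∀ ε > 0, ∃ N, ∀ n ≥ N, M n ≤ ε := by
    intro ε hε
    obtain ⟨N, hN⟩ := sE (ε / 2) (by linarith)
    refine ⟨N, fun n hn => Real.sSup_le ?_ hε.le⟩
    rintro _ ⟨w, x, y, rfl, rfl⟩
    have := hN _ _ (ent_anti f _ _ (by omega) ((ent_zero f x y).wordMap w))
    linarith [gs w x y]
  obtain ⟨hφ, hle⟩ := phi_comparison (fun n => M (n + 1)) (fun n => M0 _) (fun ε hε => by
    obtain ⟨N, hN⟩ := hM ε hε
    exact ⟨N, fun n hn => hN _ (by omega)⟩)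
  refine ⟨m, _, hφ, complete_of_ent hF hDE hED, ⟨2, fun x y => ciSup_le fun w => g2 w x y⟩, ?_⟩
  intro i x y
  refine ciSup_le fun w => le_trans ?_ (hle (D x y) w.length)
  have h1 : g w (f i x) (f i y) = ratioW w.length * g (w ++ [i]) x y := by
    simp only [g, wordMap_append, List.length_append, List.length_singleton]
    rw [cw_eq w.length, mul_assoc]
  rw [h1]
  refine mul_le_mul_of_nonneg_left (le_min (gD _ _ _) ?_) (rw_nonneg _)
  simpa using Mle (w ++ [i]) x y
end

section
/- Let X be a set, I a nonempty finite set, and f_i : X → X for each i ∈ I. The following two statements are equivalent. (I) There exist a metric D on X and a comparison function φ : [0,∞) → [0,∞) such that (X,D) is complete and each f_i is a φ-contraction with respect to D. (II) There exists a subset X₁ of X such that: (a) F(X₁) ⊆ X₁, where F : 𝒫(X) → 𝒫(X) is given by F(C) = ⋃_{i∈I} f_i(C); (b) for every α ∈ Λ(I), the set ⋂_{n∈ℕ} (X₁)_{[α]_n} has a unique element, denoted a_α; (c) whenever a_α ≠ a_β for α,β ∈ Λ(I), there exists n₀ ∈ ℕ such that (X₁)_{[α]_{n₀}} ∩ (X₁)_{[β]_{n₀}}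 = ∅; (d) for every x ∈ X there exists n_x ∈ ℕ such that F^[n_x]({x}) ⊆ X₁. -/
open Filter Topology Set

namespace PhiIFS

lemma wordMap_append {X I : Type*} (f : I → X → X) (u v : List I) (x : X) :
    WordMap f (u ++ v) x = WordMap f u (WordMap f v x) := by
  induction u with
  | nil => rfl
  | cons i u ih => simp only [List.cons_append, WordMap, Function.comp_apply, ih]

lemma pref_zero {I : Type*} (α : ℕ → I) : Pref α 0 = [] := by simp [Pref]

lemma pref_succ {I : Type*} (α : ℕ → I) (n : ℕ) :
    Pref α (n + 1) = α 0 :: Pref (fun k => α (k + 1)) n := by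
  simp [Pref, List.ofFn_succ]

lemma pref_succ_last {I : Type*} (α : ℕ → I) (n : ℕ) :
    Pref α (n + 1) = Pref α n ++ [α n] := by
  unfold Pref
  rw [List.ofFn_succ_last]
  rfl

lemma pref_length {I : Type*} (α : ℕ → I) (n : ℕ) : (Pref α n).length = n := by simp [Pref]

lemma pref_congr {I : Type*} (α β : ℕ → I) (n : ℕ) (h : ∀ k < n, α k = β k) :
    Pref α n = Pref β n := by
  unfold Pref
  congr 1
  funext k
  exact h k k.2

lemma exists_pref {I : Type*} [Nonempty I] (w : List I) : ∃ α : ℕ → I, Pref α w.length = w := by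
  induction w with
  | nil => exact ⟨fun _ => Classical.arbitrary I, by simp [Pref]⟩
  | cons i w ih =>
    obtain ⟨α, hα⟩ := ih
    refine ⟨fun k => Nat.casesOn k i α, ?_⟩
    rw [List.length_cons, pref_succ]
    exact congrArg _ hα

lemma wordMap_mem {X I : Type*} (f : I → X → X) (Y : Set X)
    (hY : (⋃ i : I, f i '' Y) ⊆ Y) (w : List I) (x : X) (hx : x ∈ Y) : WordMap f w x ∈ Y := by
  induction w with
  | nil => exact hx
  | cons i w ih => exact hY (mem_iUnion.2 ⟨i, _, ih, rfl⟩)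

lemma mem_iterate {X I : Type*} (f : I → X → X) (x : X) (n : ℕ) (y : X) :
    y ∈ (fun C : Set X => ⋃ i : I, f i '' C)^[n] {x} ↔
      ∃ w : List I, w.length = n ∧ WordMap f w x = y := by
  induction n generalizing y with
  | zero =>
    simp only [Function.iterate_zero, id, mem_singleton_iff, List.length_eq_zero_iff]
    constructor
    · rintro rfl; exact ⟨[], rfl, rfl⟩
    · rintro ⟨w, rfl, rfl⟩; rfl
  | succ n ih =>
    rw [Function.iterate_succ_apply']
    simp only [mem_iUnion, mem_image]
    constructor
    · rintro ⟨i, z, hz, rfl⟩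
      obtain ⟨w, hw, rfl⟩ := (ih z).1 hz
      exact ⟨i :: w, by simp [hw], rfl⟩
    · rintro ⟨w, hw, rfl⟩
      cases w with
      | nil => simp at hw
      | cons i w => exact ⟨i, _, (ih _).2 ⟨w, by simpa using hw, rfl⟩, rfl⟩

/-- The set `Y_{[α]_n}`. -/
def YS {X I : Type*} (f : I → X → X) (Y : Set X) (α : ℕ → I) (n : ℕ) : Set X :=
  WordMap f (Pref α n) '' Y

lemma YS_zero {X I : Type*} (f : I → X → X) (Y : Set X) (α : ℕ → I) : YS f Y α 0 = Y := by
  simp [YS, pref_zero, WordMap]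

lemma YS_succ {X I : Type*} (f : I → X → X) (Y : Set X) (α : ℕ → I) (n : ℕ) :
    YS f Y α (n + 1) = f (α 0) '' YS f Y (fun k => α (k + 1)) n := by
  rw [YS, pref_succ, WordMap, image_comp]
  rfl

lemma YS_anti {X I : Type*} (f : I → X → X) (Y : Set X)
    (hY : (⋃ i : I, f i '' Y) ⊆ Y) (α : ℕ → I) : Antitone (YS f Y α) := by
  apply antitone_nat_of_succ_le
  rintro n _ ⟨y, hy, rfl⟩
  rw [pref_succ_last, wordMap_append]
  exact ⟨_, wordMap_mem f Y hY _ _ hy, rfl⟩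

/-! ### Forward direction -/

lemma phi_le {φ : ℝ → ℝ} (hφ : IsComparisonFn φ) {t : ℝ} (ht : 0 ≤ t) : φ t ≤ t := by
  obtain ⟨h0, hm, hlt, -⟩ := hφ
  rcases ht.eq_or_lt with rfl | ht
  · refine le_of_forall_pos_le_add fun ε hε => ?_
    have := hm (mem_Ici.2 le_rfl) (mem_Ici.2 hε.le) hε.le
    linarith [hlt ε hε]
  · exact (hlt t ht).le

lemma iter_nonneg {φ : ℝ → ℝ} (hφ : IsComparisonFn φ) {t : ℝ} (ht : 0 ≤ t) (n : ℕ) :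
    0 ≤ φ^[n] t := by
  induction n with
  | zero => exact ht
  | succ n ih => rw [Function.iterate_succ_apply']; exact hφ.1 _ ih

lemma iter_mono {φ : ℝ → ℝ} (hφ : IsComparisonFn φ) {s t : ℝ} (hs : 0 ≤ s) (h : s ≤ t) (n : ℕ) :
    φ^[n] s ≤ φ^[n] t := by
  induction n with
  | zero => exact h
  | succ n ih =>
    rw [Function.iterate_succ_apply', Function.iterate_succ_apply']
    exact hφ.2.1 (iter_nonneg hφ hs n) (iter_nonneg hφ (hs.trans h) n) ih

lemma iter_anti {φ : ℝ → ℝ} (hφ : IsComparisonFn φ) {t : ℝ} (ht : 0 ≤ t) :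
    Antitone (fun n => φ^[n] t) := by
  apply antitone_nat_of_succ_le
  intro n
  rw [Function.iterate_succ_apply']
  exact phi_le hφ (iter_nonneg hφ ht n)

lemma iter_tendsto {φ : ℝ → ℝ} (hφ : IsComparisonFn φ) {t : ℝ} (ht : 0 ≤ t) :
    Tendsto (fun n => φ^[n] t) atTop (𝓝 0) := by
  have hb : BddBelow (range fun n => φ^[n] t) := ⟨0, by
    rintro _ ⟨n, rfl⟩; exact iter_nonneg hφ ht n⟩
  have hL := tendsto_atTop_ciInf (iter_anti hφ ht) hb
  set L := ⨅ n, φ^[n] t with hLdef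
  have hle : ∀ n, L ≤ φ^[n] t := fun n => ciInf_le hb n
  have hL0 : 0 ≤ L := le_ciInf fun n => iter_nonneg hφ ht n
  have h1 : Tendsto (fun n => φ^[n] t) atTop (𝓝[Ici L] L) :=
    tendsto_nhdsWithin_iff.2 ⟨hL, Eventually.of_forall hle⟩
  have h2 : Tendsto (fun n => φ (φ^[n] t)) atTop (𝓝 (φ L)) := (hφ.2.2.2 L hL0).tendsto.comp h1
  have h3 : Tendsto (fun n => φ^[n + 1] t) atTop (𝓝 L) := (tendsto_add_atTop_iff_nat 1).2 hL
  simp only [Function.iterate_succ_apply'] at h3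
  have h4 := tendsto_nhds_unique h2 h3
  rcases hL0.eq_or_lt with h | h
  · rwa [← h] at hL
  · exact absurd (hφ.2.2.1 L h) (by rw [h4]; exact lt_irrefl _)

lemma dist_wordMap {X I : Type*} [MetricSpace X] {f : I → X → X} {φ : ℝ → ℝ}
    (hφ : IsComparisonFn φ) (hf : ∀ i x y, dist (f i x) (f i y) ≤ φ (dist x y))
    (w : List I) (x y : X) :
    dist (WordMap f w x) (WordMap f w y) ≤ φ^[w.length] (dist x y) := by
  induction w with
  | nil => exact le_rfl
  | cons i w ih =>
    rw [List.length_cons, Function.iterate_succ_apply']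
    exact (hf i _ _).trans (hφ.2.1 dist_nonneg (iter_nonneg hφ dist_nonneg _) ih)

theorem forward {X I : Type*} [Finite I] [Nonempty I] [Nonempty X] [MetricSpace X]
    [CompleteSpace X] (f : I → X → X) (φ : ℝ → ℝ) (hφ : IsComparisonFn φ)
    (hf : ∀ i x y, dist (f i x) (f i y) ≤ φ (dist x y)) :
    ∃ X₁ : Set X,
        (⋃ i : I, f i '' X₁) ⊆ X₁ ∧
        (∀ α : ℕ → I, ∃! a : X, ∀ n : ℕ, a ∈ WordMap f (Pref α n) '' X₁) ∧
        (∀ α β : ℕ → I, ∀ a b : X,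
          (∀ n : ℕ, a ∈ WordMap f (Pref α n) '' X₁) →
          (∀ n : ℕ, b ∈ WordMap f (Pref β n) '' X₁) →
          a ≠ b →
          ∃ n₀ : ℕ, (WordMap f (Pref α n₀) '' X₁) ∩ (WordMap f (Pref β n₀) '' X₁) = ∅) ∧
        (∀ x : X, ∃ nx : ℕ, (fun C : Set X => ⋃ i : I, f i '' C)^[nx] {x} ⊆ X₁) := by
  obtain ⟨x0⟩ := ‹Nonempty X›
  obtain ⟨i0⟩ := ‹Nonempty I›
  obtain ⟨c, hc⟩ : ∃ c, ∀ i, dist (f i x0) x0 ≤ c := by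
    obtain ⟨c, hc⟩ := (Set.finite_range fun i => dist (f i x0) x0).bddAbove
    exact ⟨c, fun i => hc ⟨i, rfl⟩⟩
  have hc0 : 0 ≤ c := dist_nonneg.trans (hc i0)
  have h1 := hφ.2.2.1 1 one_pos
  have h2 := hφ.2.2.1 (1 / 2) (by norm_num)
  obtain ⟨n, hn⟩ : ∃ n, φ^[n] c < min (1 - φ 1) (1 / 2 - φ (1 / 2)) :=
    ((iter_tendsto hφ hc0).eventually_lt_const (lt_min (by linarith) (by linarith))).exists
  have hn1 := hn.trans_le (min_le_left _ _)
  have hn2 := hn.trans_le (min_le_right _ _)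
  let U : ℝ → Set X := fun r => {y | ∃ w : List I, w.length = n ∧ dist y (WordMap f w x0) ≤ r}
  have hinv : ∀ r, 0 ≤ r → φ^[n] c < r - φ r → (⋃ i : I, f i '' U r) ⊆ U r := by
    intro r hr hrn z hz
    obtain ⟨i, y, ⟨w, hw, hyw⟩, rfl⟩ := mem_iUnion.1 hz
    obtain ⟨w', j, hwj⟩ : ∃ w' j, i :: w = w' ++ [j] :=
      ⟨(i :: w).dropLast, (i :: w).getLast (by simp), (List.dropLast_append_getLast (by simp)).symm⟩
    have hlen : w'.length = n := by
      have := congrArg List.length hwj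
      simp at this; omega
    refine ⟨w', hlen, ?_⟩
    have e1 : dist (f i y) (f i (WordMap f w x0)) ≤ φ r :=
      (hf i _ _).trans (hφ.2.1 dist_nonneg hr hyw)
    have e2 : f i (WordMap f w x0) = WordMap f w' (f j x0) := by
      have : WordMap f (i :: w) x0 = WordMap f (w' ++ [j]) x0 := by rw [hwj]
      rw [wordMap_append] at this
      exact this
    have e3 : dist (WordMap f w' (f j x0)) (WordMap f w' x0) ≤ φ^[n] c := by
      have := dist_wordMap hφ hf w' (f j x0) x0
      rw [hlen] at this
      exact this.trans (iter_mono hφ dist_nonneg (hc j) n)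
    rw [e2] at e1
    linarith [dist_triangle (f i y) (WordMap f w' (f j x0)) (WordMap f w' x0)]
  have hfin : {w : List I | w.length = n}.Finite := List.finite_length_eq I n
  have hU : U 1 = ⋃ w ∈ {w : List I | w.length = n}, Metric.closedBall (WordMap f w x0) 1 := by
    ext y; simp [U]
  have hbdd : Bornology.IsBounded (U 1) := by
    rw [hU]; exact (Bornology.isBounded_biUnion hfin).2 fun _ _ => Metric.isBounded_closedBall
  have hclosed : IsClosed (U 1) := by
    rw [hU]; exact hfin.isClosed_biUnion fun _ _ => Metric.isClosed_closedBall
  obtain ⟨B, hB⟩ := Metric.isBounded_iff.1 hbdd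
  have hself : ∀ r, 0 ≤ r → ∀ w : List I, w.length = n → WordMap f w x0 ∈ U r :=
    fun r hr w hw => ⟨w, hw, by simpa using hr⟩
  let x1 := WordMap f (List.replicate n i0) x0
  have hx1 : x1 ∈ U 1 := hself 1 zero_le_one _ (by simp)
  have hB0 : 0 ≤ B := dist_nonneg.trans (hB hx1 hx1)
  have hi1 := hinv 1 zero_le_one hn1
  have hdiam : ∀ (α : ℕ → I) (k : ℕ) (x y : X), x ∈ YS f (U 1) α k → y ∈ YS f (U 1) α k →
      dist x y ≤ φ^[k] B := by
    rintro α k _ _ ⟨x, hx, rfl⟩ ⟨y, hy, rfl⟩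
    have := dist_wordMap hφ hf (Pref α k) x y
    rw [pref_length] at this
    exact this.trans (iter_mono hφ dist_nonneg (hB hx hy) k)
  have hu : ∀ α : ℕ → I, ∃ a, Tendsto (fun k => WordMap f (Pref α k) x1) atTop (𝓝 a) := by
    intro α
    apply cauchySeq_tendsto_of_complete
    refine cauchySeq_of_le_tendsto_0 (fun k => φ^[k] B) (fun p q N hp hq => ?_) (iter_tendsto hφ hB0)
    exact hdiam α N _ _ (YS_anti f _ hi1 α hp ⟨x1, hx1, rfl⟩) (YS_anti f _ hi1 α hq ⟨x1, hx1, rfl⟩)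
  choose a ha using hu
  have haU : ∀ α, a α ∈ U 1 := fun α =>
    hclosed.mem_of_tendsto (ha α) (Eventually.of_forall fun k => wordMap_mem f _ hi1 _ _ hx1)
  have hcont : ∀ i, Continuous (f i) := fun i =>
    (LipschitzWith.of_dist_le_mul (K := 1) fun x y => by
      simpa using (hf i x y).trans (phi_le hφ dist_nonneg)).continuous
  have hshift : ∀ α, a α = f (α 0) (a fun k => α (k + 1)) := by
    intro α
    have t1 := (tendsto_add_atTop_iff_nat 1).2 (ha α)
    have t2 := ((hcont (α 0)).tendsto _).comp (ha fun k => α (k + 1))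
    refine tendsto_nhds_unique t1 (t2.congr fun k => ?_)
    rw [pref_succ]; rfl
  have haY : ∀ k α, a α ∈ YS f (U 1) α k := by
    intro k
    induction k with
    | zero => intro α; rw [YS_zero]; exact haU α
    | succ k ih => intro α; rw [YS_succ, hshift α]; exact ⟨_, ih _, rfl⟩
  have huniq : ∀ α x, (∀ k, x ∈ YS f (U 1) α k) → x = a α := by
    intro α x hx
    refine dist_le_zero.1 (ge_of_tendsto' (iter_tendsto hφ hB0) fun k => ?_)
    exact hdiam α k _ _ (hx k) (haY k α)
  refine ⟨U 1, hi1, fun α => ⟨a α, fun k => haY k α, fun x hx => huniq α x hx⟩, ?_, ?_⟩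
  · intro α β x y hx hy hxy
    have hpos : 0 < dist x y / 2 := half_pos (dist_pos.2 hxy)
    obtain ⟨k, hk⟩ := ((iter_tendsto hφ hB0).eventually_lt_const hpos).exists
    refine ⟨k, eq_empty_iff_forall_notMem.2 ?_⟩
    rintro z ⟨hz1, hz2⟩
    have d1 := hdiam α k _ _ (hx k) hz1
    have d2 := hdiam β k _ _ hz2 (hy k)
    linarith [dist_triangle x z y]
  · intro x
    obtain ⟨k, hk, hkn⟩ := (((iter_tendsto hφ (dist_nonneg (x := x) (y := x0))).eventually_lt_const
      (show (0 : ℝ) < 1 / 2 by norm_num)).and (eventually_ge_atTop n)).exists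
    refine ⟨k, fun y hy => ?_⟩
    obtain ⟨w, hw, rfl⟩ := (mem_iterate f x k y).1 hy
    have d1 := dist_wordMap hφ hf w x x0
    rw [hw] at d1
    have hm : WordMap f w x0 ∈ U (1 / 2) := by
      have e : w = w.take (k - n) ++ w.drop (k - n) := (List.take_append_drop _ _).symm
      rw [e, wordMap_append]
      refine wordMap_mem f _ (hinv (1 / 2) (by norm_num) hn2) _ _ ?_
      exact hself _ (by norm_num) _ (by simp [hw]; omega)
    obtain ⟨v, hv, hvd⟩ := hm
    exact ⟨v, hv, by linarith [dist_triangle (WordMap f w x) (WordMap f w x0) (WordMap f v x0)]⟩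

/-! ### Backward direction -/

/-- Compactness (König) for infinite words over a finite alphabet. -/
lemma konig {J : Type*} [Finite J] (Q : ℕ → (ℕ → J) → Prop)
    (dep : ∀ n, ∃ N, ∀ α β : ℕ → J, (∀ k < N, α k = β k) → Q n α → Q n β)
    (anti : ∀ n α, Q (n + 1) α → Q n α) (ne : ∀ n, ∃ α, Q n α) : ∃ α, ∀ n, Q n α := by
  let : TopologicalSpace J := ⊥
  have : DiscreteTopology J := ⟨rfl⟩
  have hcl : ∀ n, IsClosed {α | Q n α} := by
    intro n
    obtain ⟨N, hN⟩ := dep n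
    let r : (ℕ → J) → (Fin N → J) := fun α k => α k
    have hr : Continuous r := continuous_pi fun k => continuous_apply _
    have : {α | Q n α} = r ⁻¹' (r '' {α | Q n α}) := by
      ext β
      constructor
      · intro h; exact ⟨β, h, rfl⟩
      · rintro ⟨α, hα, hαβ⟩
        exact hN α β (fun k hk => congrFun hαβ ⟨k, hk⟩) hα
    rw [this]
    exact (isClosed_discrete _).preimage hr
  obtain ⟨α, hα⟩ := IsCompact.nonempty_iInter_of_sequence_nonempty_isCompact_isClosed
    (fun n => {α | Q n α}) (fun n α h => anti n α h) ne (hcl 0).isCompact hcl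
  exact ⟨α, fun n => mem_iInter.1 hα n⟩

/-- Metrization of a countable separated base of entourages. -/
lemma metrize {X : Type*} (S : ℕ → X → X → Prop) (hanti : ∀ n x y, S (n + 1) x y → S n x y)
    (hrefl : ∀ n x, S n x x) (hsymm : ∀ n x y, S n x y → S n y x)
    (hcomp : ∀ n, ∃ m, ∀ x y z, S m x y → S m y z → S n x z)
    (hsep : ∀ x y, (∀ n, S n x y) → x = y) :
    ∃ ρ : X → X → ℝ, (∀ x, ρ x x = 0) ∧ (∀ x y, ρ x y = ρ y x) ∧
      (∀ x y z, ρ x z ≤ ρ x y + ρ y z) ∧ (∀ x y, ρ x y = 0 → x = y) ∧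
      (∀ ε > 0, ∃ n, ∀ x y, S n x y → ρ x y < ε) ∧
      (∀ n, ∃ ε > 0, ∀ x y, ρ x y < ε → S n x y) := by
  let V : ℕ → Set (X × X) := fun n => {p | S n p.1 p.2}
  have hV : Antitone V := antitone_nat_of_succ_le fun n p hp => hanti n _ _ hp
  have hb : (⨅ n, 𝓟 (V n)).HasAntitoneBasis V := HasAntitoneBasis.iInf_principal hV
  let C : UniformSpace.Core X :=
    { uniformity := ⨅ n, 𝓟 (V n)
      refl := hb.1.ge_iff.2 fun n _ => by
        rintro ⟨x, y⟩ hxy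
        obtain rfl : x = y := hxy
        exact hrefl n x
      symm := (hb.1.tendsto_iff hb.1).2 fun n _ => ⟨n, trivial, fun p hp => hsymm n _ _ hp⟩
      comp := ((hb.1.lift' (monotone_id.relComp monotone_id)).le_basis_iff hb.1).2 fun n _ => by
        obtain ⟨m, hm⟩ := hcomp n
        refine ⟨m, trivial, ?_⟩
        rintro ⟨x, z⟩ ⟨y, hxy, hyz⟩
        exact hm x y z hxy hyz }
  let U : UniformSpace X := UniformSpace.ofCore C
  have hU : (uniformity X).HasAntitoneBasis V := hb
  have : IsCountablyGenerated (uniformity X) := hU.isCountablyGenerated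
  have : T0Space X := by
    rw [t0Space_iff_uniformity]
    intro x y h
    exact hsep x y fun n => h _ (hU.mem n)
  let := UniformSpace.metricSpace X
  refine ⟨dist, dist_self, dist_comm, dist_triangle, fun x y h => dist_eq_zero.1 h, ?_, ?_⟩
  · intro ε hε
    obtain ⟨n, -, hn⟩ := hU.1.mem_iff.1 (Metric.dist_mem_uniformity hε)
    exact ⟨n, fun x y h => @hn (x, y) h⟩
  · intro n
    obtain ⟨ε, hε, h⟩ := Metric.mem_uniformity_dist.1 (hU.mem n)
    exact ⟨ε, hε, fun x y hxy => h hxy⟩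

lemma exists_phi {X I : Type*} (f : I → X → X) (d : X → X → ℝ)
    (hne : ∀ i x y, d (f i x) (f i y) ≤ d x y)
    (hP : ∀ t > 0, ∃ s < t, 0 ≤ s ∧ ∃ δ > 0, ∀ i x y, d x y < t + δ → d (f i x) (f i y) ≤ s) :
    ∃ φ, IsComparisonFn φ ∧ ∀ i x y, d (f i x) (f i y) ≤ φ (d x y) := by
  let A : ℝ → Set ℝ := fun t => {0} ∪ {r | ∃ i x y, d x y ≤ t ∧ d (f i x) (f i y) = r}
  have hA : ∀ t, BddAbove (A t) := by
    intro t
    refine ⟨max 0 t, ?_⟩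
    rintro r (hr | ⟨i, x, y, h, rfl⟩)
    · rw [hr]; exact le_max_left _ _
    · exact ((hne i x y).trans h).trans (le_max_right _ _)
  have hA0 : ∀ t, (0 : ℝ) ∈ A t := fun t => Or.inl rfl
  let ω : ℝ → ℝ := fun t => sSup (A t)
  have hω : Monotone ω := by
    intro s t hst
    apply csSup_le_csSup (hA t) ⟨0, hA0 s⟩
    rintro r (hr | ⟨i, x, y, h, rfl⟩)
    · exact Or.inl hr
    · exact Or.inr ⟨i, x, y, h.trans hst, rfl⟩
  have hω0 : ∀ t, 0 ≤ ω t := fun t => le_csSup (hA t) (hA0 t)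
  refine ⟨hω.stieltjesFunction, ⟨?_, ?_, ?_, ?_⟩, ?_⟩
  · intro t _
    rw [hω.stieltjesFunction_eq]
    exact (hω0 t).trans (hω.le_rightLim le_rfl)
  · exact hω.stieltjesFunction.mono.monotoneOn _
  · intro t ht
    obtain ⟨s, hst, hs0, δ, hδ, h⟩ := hP t ht
    rw [hω.stieltjesFunction_eq]
    refine lt_of_le_of_lt (hω.rightLim_le (show t < t + δ / 2 by linarith)) (lt_of_le_of_lt ?_ hst)
    apply csSup_le ⟨0, hA0 _⟩
    rintro r (hr | ⟨i, x, y, hxy, rfl⟩)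
    · rw [hr]; exact hs0
    · exact h i x y (by linarith)
  · intro t _
    exact hω.stieltjesFunction.right_continuous t
  · intro i x y
    rw [hω.stieltjesFunction_eq]
    exact (le_csSup (hA _) (Or.inr ⟨i, x, y, le_rfl, rfl⟩)).trans (hω.le_rightLim le_rfl)

/-- weights -/
noncomputable def sw (n : ℕ) : ℝ := 2 - 1 / (n + 1)

lemma sw_zero : sw 0 = 1 := by norm_num [sw]
lemma sw_lt (n : ℕ) : sw n < sw (n + 1) := by
  unfold sw
  have : (1 : ℝ) / ((n + 1 : ℕ) + 1) < 1 / (n + 1) := by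
    apply one_div_lt_one_div_of_lt <;> push_cast <;> first | positivity | linarith
  linarith
lemma one_le_sw (n : ℕ) : 1 ≤ sw n := by
  induction n with
  | zero => rw [sw_zero]
  | succ n ih => exact ih.trans (sw_lt n).le
lemma sw_le (n : ℕ) : sw n ≤ 2 := by
  unfold sw
  have : (0 : ℝ) ≤ 1 / (n + 1) := by positivity
  linarith
lemma sw_ratio (N : ℕ) : ∃ q : ℝ, 0 ≤ q ∧ q < 1 ∧ ∀ n < N, sw n ≤ q * sw (n + 1) := by
  induction N with
  | zero => exact ⟨0, le_rfl, one_pos, by simp⟩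
  | succ N ih =>
    obtain ⟨q, h0, h1, h⟩ := ih
    have hp : 0 < sw (N + 1) := by linarith [one_le_sw (N + 1)]
    refine ⟨max q (sw N / sw (N + 1)), h0.trans (le_max_left _ _),
      max_lt h1 ((div_lt_one hp).2 (sw_lt N)), fun n hn => ?_⟩
    have hp' : 0 ≤ sw (n + 1) := by linarith [one_le_sw (n + 1)]
    rcases Nat.lt_succ_iff_lt_or_eq.1 hn with hn | rfl
    · exact (h n hn).trans (mul_le_mul_of_nonneg_right (le_max_left _ _) hp')
    · calc sw n = sw n / sw (n + 1) * sw (n + 1) := by field_simp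
        _ ≤ _ := mul_le_mul_of_nonneg_right (le_max_right _ _) hp'

/-- Main remetrization lemma. -/
lemma remetrize {X I : Type*} [Finite I] (f : I → X → X) (ρ : X → X → ℝ)
    (h0 : ∀ x, ρ x x = 0) (hsymm : ∀ x y, ρ x y = ρ y x)
    (htri : ∀ x y z, ρ x z ≤ ρ x y + ρ y z) (hsep : ∀ x y, ρ x y = 0 → x = y)
    (hcompl : ∀ u : ℕ → X, (∀ ε > 0, ∃ N, ∀ m ≥ N, ∀ n ≥ N, ρ (u m) (u n) < ε) →
      ∃ a, ∀ ε > 0, ∃ N, ∀ n ≥ N, ρ (u n) a < ε)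
    (hcont : ∀ i, ∀ ε > 0, ∃ δ > 0, ∀ x y, ρ x y < δ → ρ (f i x) (f i y) < ε)
    (hshrink : ∀ t > 0, ∀ R, ∃ N, ∀ w : List I, N ≤ w.length → ∀ x y, ρ x y ≤ R →
      ρ (WordMap f w x) (WordMap f w y) ≤ t) :
    ∃ (m : MetricSpace X) (φ : ℝ → ℝ),
        IsComparisonFn φ ∧
        @CompleteSpace X m.toUniformSpace ∧
        (∀ i : I, ∀ x y : X, m.dist (f i x) (f i y) ≤ φ (m.dist x y)) := by
  have hnn : ∀ x y, 0 ≤ ρ x y := fun x y => by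
    have := htri x y x
    rw [h0, hsymm y x] at this; linarith
  have hswp : ∀ n, 0 < sw n := fun n => by linarith [one_le_sw n]
  let g : X → X → List I → ℝ := fun x y w => sw w.length * ρ (WordMap f w x) (WordMap f w y)
  have hg0 : ∀ x y w, 0 ≤ g x y w := fun x y w => mul_nonneg (hswp _).le (hnn _ _)
  have hbdd : ∀ x y, BddAbove (range (g x y)) := by
    intro x y
    obtain ⟨N, hN⟩ := hshrink 1 one_pos (ρ x y)
    have hfin : {w : List I | w.length < N}.Finite := List.finite_length_lt I N
    obtain ⟨B, hB⟩ := (hfin.image (g x y)).bddAbove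
    refine ⟨max B 2, ?_⟩
    rintro _ ⟨w, rfl⟩
    rcases lt_or_ge w.length N with h | h
    · exact (hB ⟨w, h, rfl⟩).trans (le_max_left _ _)
    · refine le_trans ?_ (le_max_right _ _)
      have := mul_le_mul (sw_le w.length) (hN w h x y le_rfl) (hnn _ _) (by norm_num)
      simpa using this
  let d : X → X → ℝ := fun x y => ⨆ w, g x y w
  have hgd : ∀ x y w, g x y w ≤ d x y := fun x y w => le_ciSup (hbdd x y) w
  have hρd : ∀ x y, ρ x y ≤ d x y := fun x y => by
    have := hgd x y []
    simpa [g, sw_zero, WordMap] using this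
  have hd0 : ∀ x y, 0 ≤ d x y := fun x y => (hnn x y).trans (hρd x y)
  have hdle : ∀ x y r, (∀ w, g x y w ≤ r) → d x y ≤ r := fun x y r h => ciSup_le h
  have hself : ∀ x, d x x = 0 := fun x =>
    le_antisymm (hdle _ _ _ fun w => by simp [g, h0]) (hd0 x x)
  have hcomm : ∀ x y, d x y = d y x := fun x y => by
    simp only [d, g, hsymm (WordMap f _ x) (WordMap f _ y)]
  have htriangle : ∀ x y z, d x z ≤ d x y + d y z := fun x y z => by
    refine hdle _ _ _ fun w => ?_
    have h1 := hgd x y w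
    have h2 := hgd y z w
    have h3 := mul_le_mul_of_nonneg_left
      (htri (WordMap f w x) (WordMap f w y) (WordMap f w z)) (hswp w.length).le
    simp only [g] at h1 h2 ⊢
    linarith
  let m : MetricSpace X :=
    { dist := d
      dist_self := hself
      dist_comm := hcomm
      dist_triangle := htriangle
      eq_of_dist_eq_zero := fun {x y} h => hsep x y (le_antisymm ((hρd x y).trans h.le) (hnn x y)) }
  have hgf : ∀ i x y w, ρ (WordMap f w (f i x)) (WordMap f w (f i y)) * sw (w.length + 1) ≤ d x y := by
    intro i x y w
    have := hgd x y (w ++ [i])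
    simp only [g, wordMap_append, List.length_append, List.length_singleton] at this
    rw [mul_comm]; exact this
  have hne : ∀ i x y, d (f i x) (f i y) ≤ d x y := by
    intro i x y
    refine hdle _ _ _ fun w => le_trans ?_ (hgf i x y w)
    simp only [g]
    rw [mul_comm]
    exact mul_le_mul_of_nonneg_left (sw_lt _).le (hnn _ _)
  have hP : ∀ t > 0, ∃ s < t, 0 ≤ s ∧ ∃ δ > 0, ∀ i x y, d x y < t + δ → d (f i x) (f i y) ≤ s := by
    intro t ht
    obtain ⟨N, hN⟩ := hshrink (t / 4) (by linarith) (t + 1)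
    obtain ⟨q, hq0, hq1, hq⟩ := sw_ratio N
    have hδ : 0 < min 1 (t * (1 - q)) := lt_min one_pos (mul_pos ht (by linarith))
    refine ⟨max (t / 2) (q * (t + t * (1 - q))), max_lt (by linarith) ?_,
      le_max_of_le_left (by linarith), _, hδ, fun i x y hxy => hdle _ _ _ fun w => ?_⟩
    · nlinarith [mul_pos ht (mul_pos (sub_pos.2 hq1) (sub_pos.2 hq1))]
    · have hδ1 := min_le_left 1 (t * (1 - q))
      have hδ2 := min_le_right 1 (t * (1 - q))
      rcases lt_or_ge w.length N with h | h
      · refine le_trans ?_ (le_max_right _ _)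
        have e1 := hgf i x y w
        have e2 := mul_le_mul_of_nonneg_right (hq _ h) (hnn (WordMap f w (f i x)) (WordMap f w (f i y)))
        have e3 := mul_le_mul_of_nonneg_left (e1.trans (hxy.le.trans (add_le_add_right hδ2 t))) hq0
        simp only [g]
        linarith
      · refine le_trans ?_ (le_max_left _ _)
        have := hN (w ++ [i]) (by simp; omega) x y ((hρd x y).trans (by linarith))
        simp only [wordMap_append] at this
        have h2 := mul_le_mul (sw_le w.length) this (hnn _ _) (by norm_num)
        change sw w.length * ρ (WordMap f w (f i x)) (WordMap f w (f i y)) ≤ _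
        have h3 : (2 : ℝ) * (t / 4) = t / 2 := by ring
        rw [h3] at h2
        exact h2
  obtain ⟨φ, hφ, hφd⟩ := exists_phi f d hne hP
  refine ⟨m, φ, hφ, ?_, hφd⟩
  have hcw : ∀ w : List I, ∀ ε > 0, ∃ δ > 0, ∀ x y, ρ x y < δ →
      ρ (WordMap f w x) (WordMap f w y) < ε := by
    intro w
    induction w with
    | nil => intro ε hε; exact ⟨ε, hε, fun x y h => h⟩
    | cons i w ih =>
      intro ε hε
      obtain ⟨δ, hδ, h⟩ := hcont i ε hε
      obtain ⟨δ', hδ', h'⟩ := ih δ hδ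
      exact ⟨δ', hδ', fun x y hxy => h _ _ (h' _ _ hxy)⟩
  let := m
  refine Metric.complete_of_cauchySeq_tendsto fun u hu => ?_
  have hu' : ∀ ε > 0, ∃ N, ∀ m ≥ N, ∀ n ≥ N, d (u m) (u n) < ε := Metric.cauchySeq_iff.1 hu
  obtain ⟨a, ha⟩ := hcompl u fun ε hε => by
    obtain ⟨N, hN⟩ := hu' ε hε
    exact ⟨N, fun m hm n hn => (hρd _ _).trans_lt (hN m hm n hn)⟩
  refine ⟨a, Metric.tendsto_atTop.2 fun ε hε => ?_⟩
  obtain ⟨N, hN⟩ := hu' (ε / 2) (half_pos hε)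
  refine ⟨N, fun n hn => ?_⟩
  change d (u n) a < ε
  refine lt_of_le_of_lt (hdle _ _ (ε / 2) fun w => ?_) (half_lt_self hε)
  refine le_of_forall_pos_le_add fun η hη => ?_
  obtain ⟨δ, hδ, h⟩ := hcw w (η / 2) (half_pos hη)
  obtain ⟨M, hM⟩ := ha δ hδ
  have e1 := h _ _ (hM (max M N) (le_max_left _ _))
  have e2 := (hgd (u n) (u (max M N)) w).trans (hN n hn _ (le_max_right _ _)).le
  have e3 := mul_le_mul_of_nonneg_left
      (htri (WordMap f w (u n)) (WordMap f w (u (max M N))) (WordMap f w a)) (hswp w.length).le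
  have e4 := mul_le_mul (sw_le w.length) e1.le (hnn _ _) (by norm_num)
  simp only [g] at e2 ⊢
  linarith

lemma YS_congr {X I : Type*} (f : I → X → X) (Y : Set X) (α β : ℕ → I) (n : ℕ)
    (h : ∀ k < n, α k = β k) : YS f Y α n = YS f Y β n := by
  rw [YS, YS, pref_congr α β n h]

theorem backward {X I : Type*} [Finite I] [Nonempty I] (f : I → X → X) (Y : Set X)
    (hinv : (⋃ i : I, f i '' Y) ⊆ Y)
    (hb : ∀ α : ℕ → I, ∃! a : X, ∀ n : ℕ, a ∈ YS f Y α n)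
    (hc : ∀ α β : ℕ → I, ∀ a b : X, (∀ n : ℕ, a ∈ YS f Y α n) → (∀ n : ℕ, b ∈ YS f Y β n) →
          a ≠ b → ∃ n₀ : ℕ, YS f Y α n₀ ∩ YS f Y β n₀ = ∅)
    (hd : ∀ x : X, ∃ nx : ℕ, (fun C : Set X => ⋃ i : I, f i '' C)^[nx] {x} ⊆ Y) :
    ∃ (m : MetricSpace X) (φ : ℝ → ℝ),
        IsComparisonFn φ ∧
        @CompleteSpace X m.toUniformSpace ∧
        (∀ i : I, ∀ x y : X, m.dist (f i x) (f i y) ≤ φ (m.dist x y)) := by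
  choose a ha hauniq using hb
  have hanti := YS_anti f Y hinv
  let T : ℕ → (ℕ → I) → (ℕ → I) → Prop := fun n α β => (YS f Y α n ∩ YS f Y β n).Nonempty
  have hTanti : ∀ {m n} α β, m ≤ n → T n α β → T m α β := by
    rintro m n α β hmn ⟨z, h1, h2⟩
    exact ⟨z, hanti α hmn h1, hanti β hmn h2⟩
  have hTa : ∀ α β, (∀ n, T n α β) → a α = a β := by
    intro α β h
    by_contra hne
    obtain ⟨n, hn⟩ := hc α β _ _ (ha α) (ha β) hne
    exact (h n).ne_empty hn
  have hTcongr : ∀ n α β α' β', (∀ k < n, α k = α' k) → (∀ k < n, β k = β' k) →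
      T n α β → T n α' β' := by
    intro n α β α' β' h1 h2 h
    simp only [T] at h ⊢
    rwa [← YS_congr f Y α α' n h1, ← YS_congr f Y β β' n h2]
  have hTcomp : ∀ n, ∃ m, ∀ α β γ δ, T m α β → T m β γ → T m γ δ → T n α δ := by
    intro n
    by_contra hcon
    push Not at hcon
    obtain ⟨q, hq⟩ := konig (J := I × I × I × I) (fun m q =>
      T m (fun k => (q k).1) (fun k => (q k).2.1) ∧ T m (fun k => (q k).2.1) (fun k => (q k).2.2.1) ∧
      T m (fun k => (q k).2.2.1) (fun k => (q k).2.2.2) ∧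
      ¬ T n (fun k => (q k).1) (fun k => (q k).2.2.2)) (by
        intro m
        refine ⟨max m n, fun p q hpq => ?_⟩
        have hm : ∀ k < m, p k = q k := fun k hk => hpq k (lt_max_of_lt_left hk)
        have hn : ∀ k < n, p k = q k := fun k hk => hpq k (lt_max_of_lt_right hk)
        rintro ⟨h1, h2, h3, h4⟩
        refine ⟨hTcongr m _ _ _ _ ?_ ?_ h1, hTcongr m _ _ _ _ ?_ ?_ h2,
          hTcongr m _ _ _ _ ?_ ?_ h3, fun h5 => h4 (hTcongr n _ _ _ _ ?_ ?_ h5)⟩ <;>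
        intro k hk <;> first | rw [hm k hk] | rw [hn k hk])
      (by
        rintro m q ⟨h1, h2, h3, h4⟩
        exact ⟨hTanti _ _ m.le_succ h1, hTanti _ _ m.le_succ h2, hTanti _ _ m.le_succ h3, h4⟩)
      (by
        intro m
        obtain ⟨α, β, γ, δ, h⟩ := hcon m
        exact ⟨fun k => (α k, β k, γ k, δ k), h⟩)
    have e1 := hTa _ _ fun m => (hq m).1
    have e2 := hTa _ _ fun m => (hq m).2.1
    have e3 := hTa _ _ fun m => (hq m).2.2.1
    refine (hq 0).2.2.2 ⟨_, ha _ n, ?_⟩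
    rw [e1, e2, e3]
    exact ha _ n
  let S : ℕ → X → X → Prop := fun n x y =>
    x = y ∨ ∃ α β, x ∈ YS f Y α n ∧ y ∈ YS f Y β n ∧ T n α β
  have hSanti : ∀ {m n} x y, m ≤ n → S n x y → S m x y := by
    rintro m n x y hmn (h | ⟨α, β, h1, h2, h3⟩)
    · exact Or.inl h
    · exact Or.inr ⟨α, β, hanti α hmn h1, hanti β hmn h2, hTanti _ _ hmn h3⟩
  have hScomp : ∀ n, ∃ m, ∀ x y z, S m x y → S m y z → S n x z := by
    intro n
    obtain ⟨m, hm⟩ := hTcomp n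
    refine ⟨max m n, fun x y z hxy hyz => ?_⟩
    rcases hxy with rfl | ⟨α, β, h1, h2, h3⟩
    · exact hSanti _ _ (le_max_right _ _) hyz
    rcases hyz with rfl | ⟨γ, δ, h4, h5, h6⟩
    · exact hSanti _ _ (le_max_right m n) (Or.inr ⟨α, β, h1, h2, h3⟩)
    · have hmm := le_max_left m n
      exact Or.inr ⟨α, δ, hanti α (le_max_right _ _) h1, hanti δ (le_max_right _ _) h5,
        hm α β γ δ (hTanti _ _ hmm h3) (hTanti _ _ hmm ⟨y, h2, h4⟩) (hTanti _ _ hmm h6)⟩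
  have hSsep : ∀ x y, (∀ n, S n x y) → x = y := by
    intro x y h
    by_contra hne
    obtain ⟨q, hq⟩ := konig (J := I × I) (fun m q => x ∈ YS f Y (fun k => (q k).1) m ∧
        y ∈ YS f Y (fun k => (q k).2) m ∧ T m (fun k => (q k).1) (fun k => (q k).2)) (by
          intro m
          refine ⟨m, fun p q hpq => ?_⟩
          have e1 := YS_congr f Y (fun k => (p k).1) (fun k => (q k).1) m
            (fun k hk => by rw [hpq k hk])
          have e2 := YS_congr f Y (fun k => (p k).2) (fun k => (q k).2) m
            (fun k hk => by rw [hpq k hk])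
          simp only [T, e1, e2]
          exact id)
        (by
          rintro m q ⟨h1, h2, h3⟩
          exact ⟨hanti _ m.le_succ h1, hanti _ m.le_succ h2, hTanti _ _ m.le_succ h3⟩)
        (by
          intro m
          rcases h m with h | ⟨α, β, h⟩
          · exact absurd h hne
          · exact ⟨fun k => (α k, β k), h⟩)
    have e1 := hauniq _ x fun n => (hq n).1
    have e2 := hauniq _ y fun n => (hq n).2.1
    have e3 := hTa _ _ fun n => (hq n).2.2
    exact hne (by rw [e1, e2, e3])
  obtain ⟨r, r0, rsymm, rtri, rsep, hSr, hrS⟩ := metrize S (fun n x y => hSanti x y n.le_succ)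
    (fun n x => Or.inl rfl)
    (by
      rintro n x y (h | ⟨α, β, h1, h2, h3⟩)
      · exact Or.inl h.symm
      · exact Or.inr ⟨β, α, h2, h1, by simp only [T]; rwa [inter_comm]⟩)
    hScomp hSsep
  have hSf : ∀ i n x y, S n x y → S (n + 1) (f i x) (f i y) := by
    rintro i n x y (rfl | ⟨α, β, h1, h2, z, h3, h4⟩)
    · exact Or.inl rfl
    · refine Or.inr ⟨fun k => Nat.casesOn k i α, fun k => Nat.casesOn k i β, ?_, ?_, f i z, ?_, ?_⟩ <;>
      rw [YS_succ]
      · exact ⟨x, h1, rfl⟩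
      · exact ⟨y, h2, rfl⟩
      · exact ⟨z, h3, rfl⟩
      · exact ⟨z, h4, rfl⟩
  have hSw : ∀ (w : List I) x y, x ∈ Y → y ∈ Y → S w.length (WordMap f w x) (WordMap f w y) := by
    intro w x y hx hy
    obtain ⟨α, hα⟩ := exists_pref w
    have e : YS f Y α w.length = WordMap f w '' Y := by rw [YS, hα]
    have hx' : WordMap f w x ∈ YS f Y α w.length := by rw [e]; exact ⟨x, hx, rfl⟩
    have hy' : WordMap f w y ∈ YS f Y α w.length := by rw [e]; exact ⟨y, hy, rfl⟩
    exact Or.inr ⟨α, α, hx', hy', _, hx', hx'⟩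
  -- completeness of `r`
  have hrcompl : ∀ u : ℕ → X, (∀ ε > 0, ∃ N, ∀ m ≥ N, ∀ n ≥ N, r (u m) (u n) < ε) →
      ∃ a, ∀ ε > 0, ∃ N, ∀ n ≥ N, r (u n) a < ε := by
    intro u hu
    by_cases hcase : ∃ n, ∀ K, ∃ k ≥ K, ∀ α, u k ∉ YS f Y α n
    · obtain ⟨n, hn⟩ := hcase
      obtain ⟨ε, hε, h⟩ := hrS n
      obtain ⟨N, hN⟩ := hu ε hε
      obtain ⟨k, hk, hkα⟩ := hn N
      refine ⟨u k, fun ε' hε' => ⟨N, fun j hj => ?_⟩⟩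
      rcases h _ _ (hN k hk j hj) with e | ⟨α, β, h1, -⟩
      · rw [← e, r0]; exact hε'
      · exact absurd h1 (hkα α)
    · push Not at hcase
      obtain ⟨α, hα⟩ := konig (J := I) (fun n α => ∃ k ≥ n, u k ∈ YS f Y α n)
        (by
          intro n
          refine ⟨n, fun α β h => ?_⟩
          rw [YS_congr f Y α β n h]
          exact id)
        (by
          rintro n α ⟨k, hk, h⟩
          exact ⟨k, by omega, hanti α n.le_succ h⟩)
        (by
          intro n
          obtain ⟨K, hK⟩ := hcase n
          obtain ⟨α, h⟩ := hK (max K n) (le_max_left _ _)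
          exact ⟨α, _, le_max_right _ _, h⟩)
      refine ⟨a α, fun ε hε => ?_⟩
      obtain ⟨N, hN⟩ := hu (ε / 2) (half_pos hε)
      obtain ⟨n, hn⟩ := hSr (ε / 2) (half_pos hε)
      refine ⟨N, fun j hj => ?_⟩
      obtain ⟨k, hk, hkα⟩ := hα (max n N)
      have e1 := hN j hj k ((le_max_right _ _).trans hk)
      have e2 := hn (u k) (a α) (Or.inr ⟨α, α, hanti α (le_max_left _ _) hkα, ha α n,
        a α, ha α n, ha α n⟩)
      linarith [rtri (u j) (u k) (a α)]
  -- absorption times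
  have hp : ∀ x, ∃ n : ℕ, ∀ w : List I, n ≤ w.length → WordMap f w x ∈ Y := by
    intro x
    obtain ⟨n, hn⟩ := hd x
    refine ⟨n, fun w hw => ?_⟩
    have e : w = w.take (w.length - n) ++ w.drop (w.length - n) := (List.take_append_drop _ _).symm
    rw [e, wordMap_append]
    exact wordMap_mem f Y hinv _ _ (hn ((mem_iterate f x n _).2 ⟨_, by simp; omega, rfl⟩))
  classical
  let p : X → ℕ := fun x => Nat.find (hp x)
  have hpY : ∀ x, x ∈ Y → p x = 0 := by
    intro x hx
    exact (Nat.find_eq_zero (hp x)).2 fun w _ => wordMap_mem f Y hinv w x hx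
  let e : X → X → ℝ := fun x y => if x = y then 0 else max (p x) (p y)
  have he0 : ∀ x, e x x = 0 := fun x => if_pos rfl
  have henn : ∀ x y, 0 ≤ e x y := by
    intro x y
    simp only [e]; split_ifs
    · exact le_rfl
    · positivity
  have hesymm : ∀ x y, e x y = e y x := by
    intro x y
    simp only [e, eq_comm (a := x), max_comm]
  have hetri : ∀ x y z, e x z ≤ e x y + e y z := by
    intro x y z
    by_cases hxz : x = z
    · rw [hxz, he0]; exact add_nonneg (henn _ _) (henn _ _)
    by_cases hxy : x = y
    · rw [hxy, he0, zero_add]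
    by_cases hyz : y = z
    · rw [hyz, he0, add_zero]
    simp only [e, if_neg hxz, if_neg hxy, if_neg hyz]
    have a1 := le_max_left (p x : ℝ) (p y)
    have a2 := le_max_right (p y : ℝ) (p z)
    have a3 : (0 : ℝ) ≤ p x := Nat.cast_nonneg _
    have a4 : (0 : ℝ) ≤ p z := Nat.cast_nonneg _
    exact max_le (by linarith) (by linarith)
  obtain ⟨δ₀, hδ₀, hS0⟩ := hrS 0
  have heS : ∀ x y, S 0 x y → e x y = 0 := by
    rintro x y (rfl | ⟨α, β, h1, h2, -⟩)
    · exact he0 x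
    · rw [YS_zero] at h1 h2
      simp [e, hpY x h1, hpY y h2]
  refine remetrize f (fun x y => max (r x y) (e x y)) ?_ ?_ ?_ ?_ ?_ ?_ ?_
  · intro x; simp [r0, he0]
  · intro x y; simp only [rsymm x y, hesymm x y]
  · intro x y z
    exact max_le ((rtri x y z).trans (add_le_add (le_max_left _ _) (le_max_left _ _)))
      ((hetri x y z).trans (add_le_add (le_max_right _ _) (le_max_right _ _)))
  · intro x y h
    have rnn : 0 ≤ r x y := by
      have := rtri x y x
      rw [r0, rsymm y x] at this; linarith
    exact rsep x y (le_antisymm ((le_max_left _ _).trans h.le) rnn)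
  · intro u hu
    obtain ⟨b, hb⟩ := hrcompl u fun ε hε => by
      obtain ⟨N, hN⟩ := hu ε hε
      exact ⟨N, fun m hm n hn => (le_max_left _ _).trans_lt (hN m hm n hn)⟩
    refine ⟨b, fun ε hε => ?_⟩
    obtain ⟨N, hN⟩ := hb (min ε δ₀) (lt_min hε hδ₀)
    refine ⟨N, fun n hn => ?_⟩
    have h1 := lt_min_iff.1 (hN n hn)
    exact max_lt h1.1 (by rw [heS _ _ (hS0 _ _ h1.2)]; exact hε)
  · intro i ε hε
    obtain ⟨n, hn⟩ := hSr ε hε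
    obtain ⟨δ, hδ, h⟩ := hrS n
    refine ⟨δ, hδ, fun x y hxy => ?_⟩
    have h1 := hSf i n x y (h x y ((le_max_left _ _).trans_lt hxy))
    exact max_lt (hn _ _ (hSanti _ _ n.le_succ h1))
      (by rw [heS _ _ (hSanti _ _ (Nat.zero_le _) h1)]; exact hε)
  · intro t ht R
    obtain ⟨n, hn⟩ := hSr t ht
    refine ⟨n + ⌈R⌉₊, fun w hw x y hxy => ?_⟩
    have hS : S n (WordMap f w x) (WordMap f w y) := by
      by_cases hne : x = y
      · rw [hne]; exact Or.inl rfl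
      have h1 : max (p x : ℝ) (p y) ≤ ⌈R⌉₊ := by
        have := (le_max_right _ _).trans hxy
        simp only [e, if_neg hne] at this
        exact this.trans (Nat.le_ceil R)
      have hx : p x ≤ ⌈R⌉₊ := by exact_mod_cast (le_max_left _ _).trans h1
      have hy : p y ≤ ⌈R⌉₊ := by exact_mod_cast (le_max_right _ _).trans h1
      have ew : w = w.take n ++ w.drop n := (List.take_append_drop _ _).symm
      rw [ew, wordMap_append, wordMap_append]
      have h2 := hSw (w.take n) (WordMap f (w.drop n) x) (WordMap f (w.drop n) y)
        (Nat.find_spec (hp x) _ (hx.trans (by rw [List.length_drop]; omega)))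
        (Nat.find_spec (hp y) _ (hy.trans (by rw [List.length_drop]; omega)))
      exact hSanti _ _ (by simp; omega) h2
    exact max_le (hn _ _ hS).le (by rw [heS _ _ (hSanti _ _ (Nat.zero_le _) hS)]; exact ht.le)

end PhiIFS

/-- **Theorem 4.1 (the unbounded case).** A finite family of self-maps of `X` admits a
complete metric making all its members `φ`-contractions for a single comparison
function `φ` if and only if there is a subset `X₁ ⊆ X` which is invariant under
`F(C) = ⋃ᵢ f_i(C)`, satisfies the two attractor conditions relative to `X₁`, and
absorbs every point after finitely many iterations of `F`. -/
theorem metric_comparison_iff_exists_absorbing_subset {X I : Type*} [Finite I] [Nonempty I]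
    [Nonempty X] (f : I → X → X) :
    (∃ (m : MetricSpace X) (φ : ℝ → ℝ),
        IsComparisonFn φ ∧
        @CompleteSpace X m.toUniformSpace ∧
        (∀ i : I, ∀ x y : X, m.dist (f i x) (f i y) ≤ φ (m.dist x y))) ↔
      (∃ X₁ : Set X,
        (⋃ i : I, f i '' X₁) ⊆ X₁ ∧
        (∀ α : ℕ → I, ∃! a : X, ∀ n : ℕ, a ∈ WordMap f (Pref α n) '' X₁) ∧
        (∀ α β : ℕ → I, ∀ a b : X,
          (∀ n : ℕ, a ∈ WordMap f (Pref α n) '' X₁) →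
          (∀ n : ℕ, b ∈ WordMap f (Pref β n) '' X₁) →
          a ≠ b →
          ∃ n₀ : ℕ, (WordMap f (Pref α n₀) '' X₁) ∩ (WordMap f (Pref β n₀) '' X₁) = ∅) ∧
        (∀ x : X, ∃ nx : ℕ, (fun C : Set X => ⋃ i : I, f i '' C)^[nx] {x} ⊆ X₁)) := by
  constructor
  · rintro ⟨m, φ, hφ, hcs, hf⟩
    exact PhiIFS.forward f φ hφ hf
  · rintro ⟨X₁, h1, h2, h3, h4⟩
    exact PhiIFS.backward f X₁ h1 h2 h3 h4
end
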